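/- Let 0 < α < 1 and define, for each integer n ≥ 2, S_n[β] = Σ_{k=1}^{n−1} k^{−β} − ζ(β) and σ_n = (n−1) S_n[α+1] − S_n[α] + n^{1−α}/(α(1−α)). Then there exists a constant C > 0 (depending only on α) such that for all integers n ≥ 2, | σ_n − 1/(α n^α) | ≤ C / n^{1+α}. -/

import Mathlib

/-- Real values of the Riemann zeta function at real arguments
(real part of the analytic continuation). -/
noncomputable def zr (s : ℝ) : ℝ := (riemannZeta s).re

/-- `S_n[β] = Σ_{k=1}^{n−1} k^{−β} − ζ(β)`. -/
noncomputable def S (n : ℕ) (β : ℝ) : ℝ :=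
  (∑ k ∈ Finset.Icc 1 (n - 1), (k:ℝ) ^ (-β)) - zr β

open Filter Topology

/-- The error of the trapezoid rule on an interval of length one. -/
lemma norm_trapezoid_error_le {F f f' f'' : ℝ → ℂ} {a M : ℝ}
    (hF : ∀ x ∈ Set.Icc a (a + 1), HasDerivAt F (f x) x)
    (hf : ∀ x ∈ Set.Icc a (a + 1), HasDerivAt f (f' x) x)
    (hf' : ∀ x ∈ Set.Icc a (a + 1), HasDerivAt f' (f'' x) x)
    (hM : ∀ x ∈ Set.Icc a (a + 1), ‖f'' x‖ ≤ M) :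
    ‖F (a + 1) - F a - (f (a + 1) + f a) / 2‖ ≤ M / 2 := by
  have hM0 : 0 ≤ M := (norm_nonneg _).trans (hM a ⟨le_rfl, by linarith⟩)
  have hlin (x : ℝ) : HasDerivAt (fun x : ℝ ↦ ((x : ℂ) - a) / 2) (1 / 2) x :=
    ((hasDerivAt_id (x : ℂ)).comp_ofReal.sub_const (a : ℂ)).div_const 2
  have hh (x : ℝ) (hx : x ∈ Set.Icc a (a + 1)) :
      HasDerivAt (fun x : ℝ ↦ (f x - f a) / 2 - ((x : ℂ) - a) / 2 * f' x)
        (-(((x : ℂ) - a) / 2 * f'' x)) x := by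
    convert! (((hf x hx).sub_const (f a)).div_const 2).fun_sub ((hlin x).fun_mul (hf' x hx)) using 1
    ring
  have hg (x : ℝ) (hx : x ∈ Set.Icc a (a + 1)) :
      HasDerivAt (fun x : ℝ ↦ F x - F a - ((x : ℂ) - a) / 2 * (f x + f a))
        ((f x - f a) / 2 - ((x : ℂ) - a) / 2 * f' x) x := by
    convert! ((hF x hx).sub_const (F a)).fun_sub ((hlin x).fun_mul ((hf x hx).add_const (f a))) using 1
    ring
  have hh_le (x : ℝ) (hx : x ∈ Set.Icc a (a + 1)) :
      ‖(f x - f a) / 2 - ((x : ℂ) - a) / 2 * f' x‖ ≤ M / 2 := by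
    have := norm_image_sub_le_of_norm_deriv_le_segment' (C := M / 2)
      (fun y hy ↦ (hh y hy).hasDerivWithinAt) (fun y hy ↦ ?_) x hx
    · simp only [sub_self, zero_div, zero_mul, sub_zero] at this
      nlinarith [hx.1, hx.2]
    · have hy' := Set.Ico_subset_Icc_self hy
      rw [norm_neg, norm_mul, norm_div, ← Complex.ofReal_sub, Complex.norm_real,
        Real.norm_of_nonneg (by linarith [hy'.1]), Complex.norm_ofNat]
      nlinarith [hM y hy', hy'.1, hy'.2, norm_nonneg (f'' y)]
  have := norm_image_sub_le_of_norm_deriv_le_segment' (C := M / 2)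
    (fun y hy ↦ (hg y hy).hasDerivWithinAt)
    (fun y hy ↦ hh_le y (Set.Ico_subset_Icc_self hy)) (a + 1) ⟨by linarith, le_rfl⟩
  simp only [sub_self, zero_div, zero_mul, sub_zero, add_sub_cancel_left, mul_one] at this
  convert! this using 2
  push_cast
  ring

lemma hasDerivAt_ofReal_cpow {x : ℝ} (hx : 0 < x) (r : ℂ) :
    HasDerivAt (fun y : ℝ ↦ (y : ℂ) ^ r) (r * (x : ℂ) ^ (r - 1)) x := by
  simpa using ((hasDerivAt_id (x : ℂ)).cpow_const (c := r)
    (Complex.ofReal_mem_slitPlane.2 hx)).comp_ofReal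

/-- The partial sums of the zeta series, with the first two correction terms of the
Euler–Maclaurin formula, multiplied by `1 - s`. -/
noncomputable def zetaApprox (m : ℕ) (s : ℂ) : ℂ :=
  (1 - s) * ∑ k ∈ Finset.range m, ((k : ℂ) + 1) ^ (-s) - ((m : ℂ) + 1) ^ (1 - s)
    + (1 - s) / 2 * ((m : ℂ) + 1) ^ (-s)

lemma norm_zetaApprox_succ_sub_le (m : ℕ) {s : ℂ} (hs : 0 ≤ s.re) :
    ‖zetaApprox (m + 1) s - zetaApprox m s‖ ≤
      ‖1 - s‖ * ‖s‖ * ‖s + 1‖ / 2 * ((m : ℝ) + 1) ^ (-s.re - 2) := by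
  have hpos (x : ℝ) (hx : x ∈ Set.Icc ((m : ℝ) + 1) ((m : ℝ) + 1 + 1)) : 0 < x := by
    have : (0 : ℝ) < (m : ℝ) + 1 := by positivity
    exact this.trans_le hx.1
  have key := norm_trapezoid_error_le (a := (m : ℝ) + 1)
    (F := fun x ↦ (x : ℂ) ^ (1 - s)) (f := fun x ↦ (1 - s) * (x : ℂ) ^ (-s))
    (f' := fun x ↦ (1 - s) * (-s * (x : ℂ) ^ (-s - 1)))
    (f'' := fun x ↦ (1 - s) * (-s * ((-s - 1) * (x : ℂ) ^ (-s - 1 - 1))))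
    (M := ‖1 - s‖ * ‖s‖ * ‖s + 1‖ * ((m : ℝ) + 1) ^ (-s.re - 2))
    (fun x hx ↦ by
      convert hasDerivAt_ofReal_cpow (hpos x hx) (1 - s) using 1
      ring_nf)
    (fun x hx ↦ (hasDerivAt_ofReal_cpow (hpos x hx) (-s)).const_mul _)
    (fun x hx ↦ ((hasDerivAt_ofReal_cpow (hpos x hx) (-s - 1)).const_mul _).const_mul _)
    (fun x hx ↦ by
      have h1 : ‖-s - 1‖ = ‖s + 1‖ := by rw [← norm_neg]; ring_nf
      have h2 : (-s - 1 - 1).re = -s.re - 2 := by simp; ring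
      rw [norm_mul, norm_mul, norm_mul, Complex.norm_cpow_eq_rpow_re_of_pos (hpos x hx), h1, h2,
        norm_neg, mul_assoc, mul_assoc]
      gcongr ?_ * (?_ * (?_ * ?_))
      exact Real.rpow_le_rpow_of_nonpos (by positivity) hx.1 (by linarith))
  rw [← norm_neg]
  convert key using 1
  · congr 1
    simp only [zetaApprox, Finset.sum_range_succ]
    push_cast
    ring
  · ring

lemma differentiable_zetaApprox (m : ℕ) : Differentiable ℂ (zetaApprox m) := by
  have h (k : ℕ) : (k : ℂ) + 1 ≠ 0 := Nat.cast_add_one_ne_zero k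
  have h1 (k : ℕ) : Differentiable ℂ fun s : ℂ ↦ ((k : ℂ) + 1) ^ (-s) := fun s ↦
    differentiableAt_id.neg.const_cpow (Or.inl (h k))
  have h2 : Differentiable ℂ fun s : ℂ ↦ ((m : ℂ) + 1) ^ (1 - s) := fun s ↦
    (differentiableAt_id.const_sub 1).const_cpow (Or.inl (h m))
  unfold zetaApprox
  fun_prop

lemma tendsto_add_one_cpow_atTop {r : ℂ} (hr : r.re < 0) :
    Tendsto (fun m : ℕ ↦ ((m : ℂ) + 1) ^ r) atTop (𝓝 0) := by
  rw [tendsto_zero_iff_norm_tendsto_zero]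
  have h : Tendsto (fun m : ℕ ↦ ((m : ℝ) + 1) ^ (-(-r.re))) atTop (𝓝 0) :=
    (tendsto_rpow_neg_atTop (neg_pos.2 hr)).comp
      (tendsto_atTop_add_const_right _ _ tendsto_natCast_atTop_atTop)
  refine h.congr fun m ↦ ?_
  rw [neg_neg, ← Complex.norm_cpow_eq_rpow_re_of_pos (by positivity)]
  push_cast
  rfl

lemma tendsto_zetaApprox_of_one_lt_re {s : ℂ} (hs : 1 < s.re) :
    Tendsto (fun m ↦ zetaApprox m s) atTop (𝓝 (-riemannZeta₁ s)) := by
  have hs1 : s ≠ 1 := by rintro rfl; simp at hs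
  have hsum : Summable fun n : ℕ ↦ 1 / ((n : ℂ) + 1) ^ s := by
    have := (summable_nat_add_iff 1).2 (Complex.summable_one_div_nat_cpow.2 hs)
    simpa using this
  have h1 : Tendsto (fun m : ℕ ↦ ∑ k ∈ Finset.range m, ((k : ℂ) + 1) ^ (-s)) atTop
      (𝓝 (riemannZeta s)) := by
    rw [zeta_eq_tsum_one_div_nat_add_one_cpow hs]
    simpa only [Complex.cpow_neg, one_div] using hsum.hasSum.tendsto_sum_nat
  have h2 := tendsto_add_one_cpow_atTop (r := 1 - s) (by simpa using hs)
  have h3 := tendsto_add_one_cpow_atTop (r := -s) (by simp; linarith)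
  convert ((h1.const_mul (1 - s)).sub h2).add (h3.const_mul ((1 - s) / 2)) using 2
  · rfl
  rw [riemannZeta_eq_inv_sub_mul hs1]
  have := sub_ne_zero.2 hs1
  field_simp
  ring

lemma tendsto_zetaApprox {s : ℂ} (hs : 0 < s.re) :
    Tendsto (fun m ↦ zetaApprox m s) atTop (𝓝 (-riemannZeta₁ s)) := by
  set R : ℝ := ‖s‖ + 3
  set U : Set ℂ := {z | 0 < z.re} ∩ Metric.ball 0 R
  have hUo : IsOpen U := (isOpen_lt continuous_const Complex.continuous_re).inter Metric.isOpen_ball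
  have hUc : IsPreconnected U :=
    ((convex_halfSpace_re_gt 0).inter (convex_ball 0 R)).isPreconnected
  have hu : Summable fun m : ℕ ↦ (1 + R) * R * (R + 1) / 2 * ((m : ℝ) + 1) ^ (-2 : ℝ) := by
    have := (summable_nat_add_iff 1).2 (Real.summable_nat_rpow.2 (show (-2 : ℝ) < -1 by norm_num))
    refine Summable.mul_left _ ?_
    simpa using this
  have hle (m : ℕ) (z : ℂ) (hz : z ∈ U) : ‖zetaApprox (m + 1) z - zetaApprox m z‖ ≤
      (1 + R) * R * (R + 1) / 2 * ((m : ℝ) + 1) ^ (-2 : ℝ) := by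
    have hz0 : 0 < z.re := hz.1
    have hzR : ‖z‖ ≤ R := (mem_ball_zero_iff.1 hz.2).le
    refine (norm_zetaApprox_succ_sub_le m hz0.le).trans ?_
    have h1 : ‖1 - z‖ ≤ 1 + R := (norm_sub_le _ _).trans (by simpa using hzR)
    have h2 : ‖z + 1‖ ≤ R + 1 := (norm_add_le _ _).trans (by simpa using hzR)
    gcongr
    · linarith
    · linarith
  set T : ℂ → ℂ := fun z ↦ ∑' m : ℕ, (zetaApprox (m + 1) z - zetaApprox m z)
  have hT : DifferentiableOn ℂ T U := Complex.differentiableOn_tsum_of_summable_norm hu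
    (fun m ↦ ((differentiable_zetaApprox _).sub (differentiable_zetaApprox _)).differentiableOn)
    hUo hle
  have hlim (z : ℂ) (hz : z ∈ U) :
      Tendsto (fun m ↦ zetaApprox m z) atTop (𝓝 (T z + zetaApprox 0 z)) := by
    have h : Summable fun m : ℕ ↦ zetaApprox (m + 1) z - zetaApprox m z :=
      Summable.of_norm_bounded hu fun m ↦ hle m z hz
    refine (h.hasSum.tendsto_sum_nat.add_const (zetaApprox 0 z)).congr fun m ↦ ?_
    rw [Finset.sum_range_sub (fun m ↦ zetaApprox m z), sub_add_cancel]
  have h2U : (2 : ℂ) ∈ U := by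
    refine ⟨by simp, ?_⟩
    have := norm_nonneg s
    simp only [Metric.mem_ball, dist_zero_right, Complex.norm_ofNat, R]
    linarith
  have heq : Set.EqOn (fun z ↦ T z + zetaApprox 0 z) (fun z ↦ -riemannZeta₁ z) U := by
    refine AnalyticOnNhd.eqOn_of_preconnected_of_eventuallyEq
      ((hT.add (differentiable_zetaApprox 0).differentiableOn).analyticOnNhd hUo)
      (differentiable_riemannZeta₁.neg.differentiableOn.analyticOnNhd hUo) hUc h2U ?_
    filter_upwards [hUo.mem_nhds h2U,
      (isOpen_lt continuous_const Complex.continuous_re).mem_nhds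
        (show (1 : ℝ) < (2 : ℂ).re by simp)] with z hzU hz1
    exact tendsto_nhds_unique (hlim z hzU) (tendsto_zetaApprox_of_one_lt_re hz1)
  have hsU : s ∈ U := ⟨hs, by simp [R]⟩
  exact (hlim s hsU).trans_eq (congrArg 𝓝 (heq hsU))

lemma rpow_neg_sub_one_le_sub {p x : ℝ} (hp : 1 ≤ p) (hx : 1 ≤ x) :
    x ^ (-p - 1) ≤ 2 * (x ^ (-p) - (x + 1) ^ (-p)) := by
  have hx0 : 0 < x := by linarith
  have h1 : (x / (x + 1)) ^ p ≤ x / (x + 1) :=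
    (Real.rpow_le_rpow_of_exponent_ge (by positivity)
      ((div_le_one (by positivity)).2 (by linarith)) hp).trans_eq (Real.rpow_one _)
  have h2 : (x + 1) ^ (-p) = x ^ (-p) * (x / (x + 1)) ^ p := by
    rw [Real.div_rpow hx0.le (by positivity), Real.rpow_neg hx0.le, Real.rpow_neg (by positivity)]
    have := (Real.rpow_pos_of_pos hx0 p).ne'
    field_simp
  rw [h2, Real.rpow_sub_one hx0.ne']
  have h3 : 1 / x ≤ 2 * (1 - x / (x + 1)) := by
    rw [one_sub_div (by positivity), add_sub_cancel_left, mul_one_div,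
      div_le_div_iff₀ hx0 (by positivity)]
    linarith
  have h4 : 0 < x ^ (-p) := by positivity
  calc x ^ (-p) / x = x ^ (-p) * (1 / x) := by ring
    _ ≤ x ^ (-p) * (2 * (1 - (x / (x + 1)) ^ p)) := by gcongr; linarith
    _ = _ := by ring

lemma norm_zetaApprox_add_riemannZeta₁_le (m : ℕ) {s : ℂ} (hs : 0 < s.re) :
    ‖zetaApprox m s + riemannZeta₁ s‖ ≤
      ‖1 - s‖ * ‖s‖ * ‖s + 1‖ * ((m : ℝ) + 1) ^ (-(s.re + 1)) := by
  set c := ‖1 - s‖ * ‖s‖ * ‖s + 1‖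
  have hstep (k : ℕ) : ‖zetaApprox (k + 1) s - zetaApprox k s‖ ≤
      c * (((k : ℝ) + 1) ^ (-(s.re + 1)) - (((k + 1 : ℕ) : ℝ) + 1) ^ (-(s.re + 1))) := by
    refine (norm_zetaApprox_succ_sub_le k hs.le).trans ?_
    have h := rpow_neg_sub_one_le_sub (p := s.re + 1) (x := (k : ℝ) + 1) (by linarith) (by simp)
    have e : -s.re - 2 = -(s.re + 1) - 1 := by ring
    have hc : 0 ≤ c := by positivity
    rw [e]
    push_cast
    nlinarith
  have hdiff (N : ℕ) (hN : m ≤ N) : ‖zetaApprox m s - zetaApprox N s‖ ≤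
      c * (((m : ℝ) + 1) ^ (-(s.re + 1)) - ((N : ℝ) + 1) ^ (-(s.re + 1))) := by
    induction N, hN using Nat.le_induction with
    | base => simp
    | succ N hN ih =>
      have h := norm_sub_le_norm_sub_add_norm_sub (zetaApprox m s) (zetaApprox N s)
        (zetaApprox (N + 1) s)
      rw [norm_sub_rev (zetaApprox N s)] at h
      linarith [hstep N]
  have hlim : Tendsto (fun N ↦ ‖zetaApprox m s - zetaApprox N s‖) atTop
      (𝓝 ‖zetaApprox m s + riemannZeta₁ s‖) := by
    simpa using ((tendsto_zetaApprox hs).const_sub (zetaApprox m s)).norm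
  refine le_of_tendsto hlim ((eventually_ge_atTop m).mono fun N hN ↦ (hdiff N hN).trans ?_)
  gcongr
  exact sub_le_self _ (by positivity)

lemma exists_abs_S_sub_le {β : ℝ} (hβ : 0 < β) (hβ1 : β ≠ 1) :
    ∃ C ≥ 0, ∀ n : ℕ, 1 ≤ n →
      |S n β - ((n : ℝ) ^ (1 - β) / (1 - β) - (n : ℝ) ^ (-β) / 2)| ≤ C * (n : ℝ) ^ (-(β + 1)) := by
  have hβ' : (β : ℂ) ≠ 1 := by exact_mod_cast hβ1
  have hsub : (1 - β : ℂ) ≠ 0 := sub_ne_zero.2 hβ'.symm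
  refine ⟨‖(β : ℂ)‖ * ‖(β : ℂ) + 1‖, by positivity, fun n hn ↦ ?_⟩
  obtain ⟨m, rfl⟩ := Nat.exists_eq_add_of_le' hn
  have hb := norm_zetaApprox_add_riemannZeta₁_le m (s := β) (by simpa using hβ)
  have hS : S (m + 1) β - (((m + 1 : ℕ) : ℝ) ^ (1 - β) / (1 - β) - ((m + 1 : ℕ) : ℝ) ^ (-β) / 2)
      = ((zetaApprox m β + riemannZeta₁ β) / (1 - β)).re := by
    have e : (zetaApprox m β + riemannZeta₁ β) / (1 - β) =
        ((∑ k ∈ Finset.range m, ((k : ℝ) + 1) ^ (-β) - ((m : ℝ) + 1) ^ (1 - β) / (1 - β)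
          + ((m : ℝ) + 1) ^ (-β) / 2 : ℝ) : ℂ) - riemannZeta β := by
      have hsum : ((∑ k ∈ Finset.range m, ((k : ℝ) + 1) ^ (-β) : ℝ) : ℂ) =
          ∑ k ∈ Finset.range m, ((k : ℂ) + 1) ^ (-β : ℂ) := by
        rw [Complex.ofReal_sum]
        refine Finset.sum_congr rfl fun k _ ↦ ?_
        rw [Complex.ofReal_cpow (by positivity)]
        push_cast
        rfl
      have hsub' : (β - 1 : ℂ) ≠ 0 := sub_ne_zero.2 hβ'
      rw [riemannZeta_eq_inv_sub_mul hβ', zetaApprox]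
      push_cast [hsum, Complex.ofReal_cpow (show (0 : ℝ) ≤ (m : ℝ) + 1 by positivity)]
      field_simp
      ring
    have hIcc : ∑ k ∈ Finset.Icc 1 m, (k : ℝ) ^ (-β) =
        ∑ k ∈ Finset.range m, ((k : ℝ) + 1) ^ (-β) := by
      rw [Finset.range_eq_Ico, ← Finset.Ico_add_one_right_eq_Icc,
        ← Finset.sum_Ico_add' (fun k : ℕ ↦ (k : ℝ) ^ (-β)) 0 m 1]
      push_cast
      rfl
    rw [e, Complex.sub_re, Complex.ofReal_re, S, zr, Nat.add_sub_cancel, hIcc]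
    push_cast
    ring
  rw [hS]
  refine (Complex.abs_re_le_norm _).trans ?_
  rw [norm_div, div_le_iff₀ (norm_pos_iff.2 hsub)]
  refine hb.trans_eq ?_
  push_cast
  rw [Complex.ofReal_re]
  ring

theorem last_weight_asymptotics
    (α : ℝ) (hα0 : 0 < α) (hα1 : α < 1) :
    ∃ C > 0, ∀ n : ℕ, 2 ≤ n →
      |(((n:ℝ) - 1) * S n (α + 1) - S n α + (n:ℝ) ^ (1 - α) / (α * (1 - α)))
          - 1 / (α * (n:ℝ) ^ α)|
      ≤ C / (n:ℝ) ^ (1 + α) := by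
  obtain ⟨A, hA, hSA⟩ := exists_abs_S_sub_le (β := α + 1) (by linarith) (by linarith)
  obtain ⟨B, hB, hSB⟩ := exists_abs_S_sub_le hα0 hα1.ne
  refine ⟨A + B + 1, by positivity, fun n hn ↦ ?_⟩
  have hn0 : (0 : ℝ) < n := by positivity
  have hn1 : (1 : ℝ) ≤ n := by exact_mod_cast (by omega : 1 ≤ n)
  have ha := hSA n (by omega)
  have hb := hSB n (by omega)
  set P : ℝ := (n : ℝ) ^ (-(α + 1))
  have hP : 0 < P := by positivity
  have e1 : (n : ℝ) ^ (-(α + 1 + 1)) = P / n := by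
    rw [neg_add _ (1 : ℝ), ← sub_eq_add_neg, Real.rpow_sub_one hn0.ne']
  have e2 : (n : ℝ) ^ (-α) = P * n := by
    rw [← Real.rpow_add_one hn0.ne']; ring_nf
  have e3 : (n : ℝ) ^ (1 - α) = P * n * n := by
    rw [← e2, ← Real.rpow_add_one hn0.ne']; ring_nf
  have e4 : (n : ℝ) ^ (1 - (α + 1)) = P * n := by
    rw [← e2]; ring_nf
  have e5 : 1 / (α * (n : ℝ) ^ α) = P * n / α := by
    rw [← e2, Real.rpow_neg hn0.le]; field_simp
  have e6 : (A + B + 1) / (n : ℝ) ^ (1 + α) = (A + B + 1) * P := by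
    rw [div_eq_mul_inv, ← Real.rpow_neg hn0.le, add_comm 1 α]
  rw [e1, e4] at ha
  rw [e2, e3] at hb
  rw [e3, e5, e6]
  set X := S n (α + 1) - (P * n / (1 - (α + 1)) - P / 2)
  set Y := S n α - (P * n * n / (1 - α) - P * n / 2)
  have hdecomp : ((n : ℝ) - 1) * S n (α + 1) - S n α + P * n * n / (α * (1 - α)) - P * n / α
      = ((n : ℝ) - 1) * X - Y + P / 2 := by
    have : 1 - α ≠ 0 := by linarith
    have : 1 - (α + 1) = -α := by ring
    simp only [X, Y, this]
    field_simp
    ring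
  have hX : |((n : ℝ) - 1) * X| ≤ A * P := by
    rw [abs_mul, abs_of_nonneg (by linarith)]
    calc ((n : ℝ) - 1) * |X| ≤ n * (A * (P / n)) := by gcongr; linarith
      _ = A * P := by field_simp
  rw [hdecomp]
  rw [abs_le] at hX hb ⊢
  constructor <;> linarith [hX.1, hX.2, hb.1, hb.2]
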